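/- The swap-and-reduce map sends degenerate trees to nondegenerate trees: Let A ⊆ ℕ be finite with #A ≥ 2 and let T ∈ 𝕋̃_A ∖ 𝕋_A, so that T has exactly one degenerate label i = I(T); let j = J(T) := J(𝐭, i). Then ϱ(T) ∈ 𝕋_{A∖{j}}: the swap-and-reduce image ϱ(T) is an (A∖{j})-tree that has no degenerate label and whose type-2 edges {u,v} all satisfy x'_u + x'_v > 0. -/

import Mathlib

open scoped Classical

namespace AldousTrees

/-- The edges of a tree shape with label set `A`: the internal edges in `t` together with the
leaf edges `{a}`, `a ∈ A`. -/
def edges (A : Finset ℕ) (t : Finset (Finset ℕ)) : Finset (Finset ℕ) :=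
  t ∪ A.image fun a => ({a} : Finset ℕ)

/-- `C` is a child of `E`: a maximal proper member of `edges A t` contained in `E`. -/
def IsChild (A : Finset ℕ) (t : Finset (Finset ℕ)) (C E : Finset ℕ) : Prop :=
  C ∈ edges A t ∧ C ⊂ E ∧ ∀ F ∈ edges A t, C ⊂ F → ¬ F ⊂ E

/-- `t` is (the edge-set representation of) a tree shape with label set `A`: a rooted binary
combinatorial tree with leaves labelled by `A` and root of degree one.  `t` is the collection
of internal edges, each represented by the set of leaf labels above it. -/
structure IsTreeShape (A : Finset ℕ) (t : Finset (Finset ℕ)) : Prop where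
  nonempty_ground : A.Nonempty
  subset_ground : ∀ E ∈ t, E ⊆ A
  two_le_card : ∀ E ∈ t, 2 ≤ E.card
  ground_mem : 2 ≤ A.card → A ∈ t
  nested_or_disjoint : ∀ E ∈ edges A t, ∀ F ∈ edges A t, E ⊆ F ∨ F ⊆ E ∨ Disjoint E F
  binary : ∀ E ∈ t, ∃ C₁ C₂, IsChild A t C₁ E ∧ IsChild A t C₂ E ∧ C₁ ≠ C₂ ∧
    Disjoint C₁ C₂ ∧ C₁ ∪ C₂ = E ∧ ∀ C, IsChild A t C E → C = C₁ ∨ C = C₂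

/-- The number of children of the internal edge `E` that are leaf edges; an internal edge is of
type `d` if exactly `d` of its two children are leaf edges. -/
noncomputable def leafChildCount (A : Finset ℕ) (t : Finset (Finset ℕ)) (E : Finset ℕ) : ℕ :=
  ((A.image fun a => ({a} : Finset ℕ)).filter fun C => IsChild A t C E).card

end AldousTrees

namespace AldousTrees

open MeasureTheory Filter Set

noncomputable section

/-! ### Interval partitions -/

/-- An interval partition is recorded as a pair `(mass, blocks)`: a real mass `M` together
with the set of (endpoint pairs of) its open interval blocks. -/
abbrev IP : Type := ℝ × Set (ℝ × ℝ)

/-- The trivial (empty) interval partition. -/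
def IP.zero : IP := (0, ∅)

/-- `β` is an interval partition of `[0, β.1]`: its blocks are disjoint nonempty open
subintervals of `[0, β.1]` covering `[0, β.1]` up to a Lebesgue-null set. -/
def IsIntervalPartition (β : IP) : Prop :=
  0 ≤ β.1 ∧
  (∀ p ∈ β.2, 0 ≤ p.1 ∧ p.1 < p.2 ∧ p.2 ≤ β.1) ∧
  (β.2.Pairwise fun p q => Disjoint (Ioo p.1 p.2) (Ioo q.1 q.2)) ∧
  volume (Icc (0 : ℝ) β.1 \ ⋃ p ∈ β.2, Ioo p.1 p.2) = 0

/-- `𝒟_β(t) = d`: the ½-diversity of `β` up to the point `t` exists and equals `d`, i.e.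
`√π · √h · #{(a,b) ∈ β : b − a > h, b < t} → d` as `h ↓ 0`. -/
def HasDiversity (β : IP) (t d : ℝ) : Prop :=
  Tendsto
    (fun h : ℝ => Real.sqrt Real.pi * Real.sqrt h *
      ({p : ℝ × ℝ | p ∈ β.2 ∧ h < p.2 - p.1 ∧ p.2 < t}.ncard : ℝ))
    (nhdsWithin 0 (Ioi 0)) (nhds d)

/-- `𝒟_β(∞) = d`: the total ½-diversity of `β` exists and equals `d`. -/
def HasTotalDiversity (β : IP) (d : ℝ) : Prop :=
  Tendsto
    (fun h : ℝ => Real.sqrt Real.pi * Real.sqrt h *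
      ({p : ℝ × ℝ | p ∈ β.2 ∧ h < p.2 - p.1}.ncard : ℝ))
    (nhdsWithin 0 (Ioi 0)) (nhds d)

/-- `β ∈ 𝓘`: `β` is an interval partition with the ½-diversity property. -/
def MemIcal (β : IP) : Prop :=
  IsIntervalPartition β ∧ ∀ t : ℝ, 0 ≤ t → ∃ d, HasDiversity β t d

/-- Concatenation `α ⋆ β` of interval partitions. -/
def IP.concat (α β : IP) : IP :=
  (α.1 + β.1, α.2 ∪ (fun p : ℝ × ℝ => (α.1 + p.1, α.1 + p.2)) '' β.2)

/-- The interval partition `(0,x)` consisting of a single block of mass `x > 0`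
(empty if `x = 0`). -/
def IP.single (x : ℝ) : IP := (x, if 0 < x then {((0 : ℝ), x)} else ∅)

/-- The interval partition `β` scaled by `c`. -/
def IP.scale (c : ℝ) (β : IP) : IP :=
  (c * β.1, (fun p : ℝ × ℝ => (c * p.1, c * p.2)) '' β.2)

/-- The part of `β` strictly to the left of the block `(a,b)` (an interval partition of
`[0,a]`). -/
def IP.before (β : IP) (a : ℝ) : IP := (a, {p ∈ β.2 | p.2 ≤ a})

/-- The part of `β` strictly to the right of the block `(a,b)`, shifted to start at `0`. -/
def IP.after (β : IP) (b : ℝ) : IP :=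
  (β.1 - b, (fun p : ℝ × ℝ => (p.1 - b, p.2 - b)) '' {p ∈ β.2 | b ≤ p.1})

/-! ### A-trees -/

/-- An `A`-tree: a tree shape together with top masses on the leaves and interval partitions
on the internal edges.  `top` and `part` are total functions; membership in `𝕋_A` requires
them to vanish off the label set/shape. -/
structure ATree : Type where
  shape : Finset (Finset ℕ)
  top : ℕ → ℝ
  part : Finset ℕ → IP

/-- The parent edge `parent(E) = ⋂ {F ∈ t : E ⊊ F}` of `E` (computed inside the ground set
`⋃ t`; it equals `⋃ t` if no edge strictly contains `E`). -/
def parentEdge (t : Finset (Finset ℕ)) (E : Finset ℕ) : Finset ℕ :=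
  (t.sup id).filter fun x => ∀ F ∈ t, E ⊂ F → x ∈ F

/-- Label `i` is degenerate in `T`: `x_i + ‖β_{parent({i})}‖ = 0`. -/
def Degenerate (T : ATree) (i : ℕ) : Prop :=
  T.top i + (T.part (parentEdge T.shape {i})).1 = 0

/-- The basic requirements for `T` to be an `A`-tree: the shape is a tree shape on `A`, top
masses are nonnegative (and vanish off `A`), edge partitions lie in `𝓘` (and are trivial off
the shape), and `x_i + x_j > 0` for every type-2 edge `{i,j}`. -/
def PreTree (A : Finset ℕ) (T : ATree) : Prop :=
  IsTreeShape A T.shape ∧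
  (∀ i ∈ A, 0 ≤ T.top i) ∧ (∀ i, i ∉ A → T.top i = 0) ∧
  (∀ E ∈ T.shape, MemIcal (T.part E)) ∧ (∀ E, E ∉ T.shape → T.part E = IP.zero) ∧
  (∀ E ∈ T.shape, E.card = 2 → 0 < ∑ i ∈ E, T.top i)

/-- `T ∈ 𝕋_A`: an `A`-tree with no degenerate label. -/
def MemT (A : Finset ℕ) (T : ATree) : Prop :=
  PreTree A T ∧ ∀ i ∈ A, ¬ Degenerate T i

/-- `T ∈ 𝕋̃_A`: an `A`-tree with at most one degenerate label. -/
def MemTtilde (A : Finset ℕ) (T : ATree) : Prop :=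
  PreTree A T ∧ ∀ i ∈ A, ∀ i' ∈ A, Degenerate T i → Degenerate T i' → i = i'

/-- The projection `π_{−j}` removing label `j` from an `A`-tree.  If `parent({j})` is a
type-2 edge `{a,j}`, the whole compound is absorbed into the top mass of `a`; otherwise the
partitions of the sibling edge, the block `(0,x_j)` and the parent edge are concatenated onto
the sibling edge `parent({j}) ∖ {j}`; all other components are carried over along
`E ↦ E ∖ {j}`. -/
def proj (j : ℕ) (T : ATree) : ATree :=
  letI P := parentEdge T.shape {j}
  letI t' := (T.shape.erase P).image fun E => E.erase j
  { shape := t'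
    top := fun i =>
      if i = j then 0
      else if P.card = 2 ∧ i ∈ P then T.top i + T.top j + (T.part P).1
      else T.top i
    part := fun F =>
      if F ∈ t' then
        if P.card ≠ 2 ∧ F = P.erase j then
          IP.concat (IP.concat (T.part (P.erase j)) (IP.single (T.top j))) (T.part P)
        else if insert j F ∈ T.shape ∧ insert j F ≠ P then T.part (insert j F)
        else T.part F
      else IP.zero }

end

end AldousTrees

namespace AldousTrees

noncomputable section

/-- The smallest label of an edge (`0` for the empty set). -/
def minLabel (E : Finset ℕ) : ℕ := sInf (E : Set ℕ)

/-- The relabelling map `φ_{𝐭,i}`: from a label set, first delete `i`, then replace `j`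
by `i` (if present). -/
def relabel (i j : ℕ) (E : Finset ℕ) : Finset ℕ :=
  if j ∈ E.erase i then insert i ((E.erase i).erase j) else E.erase i

/-- `J(𝐭,i) = max {i, a, b}`, where `a` is the smallest label of the sibling of the leaf
edge `{i}` and `b` is the smallest label of its uncle (`b = 0` if `parent({i}) = A`).  In a
tree shape the sibling of `{i}` is `parent({i}) ∖ {i}` and the uncle is
`parent(parent({i})) ∖ parent({i})`. -/
def Jmap (A : Finset ℕ) (t : Finset (Finset ℕ)) (i : ℕ) : ℕ :=
  letI P := parentEdge t {i}
  max i (max (minLabel (P \ {i}))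
    (if P = A then 0 else minLabel (parentEdge t P \ P)))

/-- The swap-and-reduce map `ϱ` on `A`-trees with degenerate label `i` and `j = J(𝐭,i)`:
labels `i` and `j` are swapped, then the (degenerate) leaf subsequently labelled `j` is
deleted and its parent branch point contracted away.  The tree shape becomes the image of
`𝐭 ∖ {parent({i})}` under `φ_{𝐭,i}`, the top mass of `i` becomes `x_j` (if `i ≠ j`), all
other top masses are unchanged, and `β'_E = β_{φ_{𝐭,i}⁻¹(E)}` for each new edge `E`. -/
def swapReduce (i j : ℕ) (T : ATree) : ATree :=
  letI P := parentEdge T.shape {i}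
  letI t' := (T.shape.erase P).image (relabel i j)
  { shape := t'
    top := fun a =>
      if a = j then 0
      else if a = i then T.top j
      else T.top a
    part := fun E =>
      if h : ∃ F ∈ T.shape.erase P, relabel i j F = E then T.part h.choose
      else IP.zero }

theorem mem_edges {A : Finset ℕ} {t : Finset (Finset ℕ)} {E : Finset ℕ} :
    E ∈ edges A t ↔ E ∈ t ∨ ∃ a ∈ A, {a} = E := by
  simp [edges]

theorem mem_relabel {i j x : ℕ} {E : Finset ℕ} :
    x ∈ relabel i j E ↔ x ≠ j ∧ Equiv.swap i j x ∈ E := by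
  unfold relabel
  rw [Equiv.swap_apply_def]
  grind

theorem relabel_mono {i j : ℕ} {E F : Finset ℕ} (h : E ⊆ F) :
    relabel i j E ⊆ relabel i j F := by
  intro x hx
  rw [mem_relabel] at hx ⊢
  exact ⟨hx.1, h hx.2⟩

theorem relabel_eq_image (i j : ℕ) (E : Finset ℕ) :
    relabel i j E = (E.erase i).image (Equiv.swap i j) := by
  ext x
  rw [mem_relabel, Finset.mem_image]
  constructor
  · rintro ⟨hx, hE⟩
    refine ⟨_, Finset.mem_erase.2 ⟨fun h => hx ?_, hE⟩, Equiv.swap_apply_self i j x⟩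
    rw [← Equiv.swap_apply_self i j x, h, Equiv.swap_apply_left]
  · rintro ⟨y, hy, rfl⟩
    rw [Finset.mem_erase] at hy
    refine ⟨fun h => hy.1 ?_, by rw [Equiv.swap_apply_self]; exact hy.2⟩
    rw [← Equiv.swap_apply_self i j y, h, Equiv.swap_apply_right]

theorem swap_mem_relabel {i j a : ℕ} {E : Finset ℕ} (ha : a ∈ E) (hai : a ≠ i) :
    Equiv.swap i j a ∈ relabel i j E := by
  rw [relabel_eq_image]
  exact Finset.mem_image_of_mem _ (Finset.mem_erase.2 ⟨hai, ha⟩)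

theorem card_relabel (i j : ℕ) (E : Finset ℕ) : (relabel i j E).card = (E.erase i).card := by
  rw [relabel_eq_image, Finset.card_image_of_injective _ (Equiv.injective _)]

theorem relabel_erase (i j : ℕ) (E : Finset ℕ) : relabel i j (E.erase i) = relabel i j E := by
  simp [relabel_eq_image]

theorem relabel_ground {A : Finset ℕ} {i j : ℕ} (hi : i ∈ A) (hj : j ∈ A) :
    relabel i j A = A.erase j := by
  ext x
  rw [mem_relabel, Finset.mem_erase, Equiv.swap_apply_def]
  grind

theorem erase_eq_of_relabel_eq {i j : ℕ} {E F : Finset ℕ}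
    (h : relabel i j E = relabel i j F) : E.erase i = F.erase i := by
  rw [relabel_eq_image, relabel_eq_image] at h
  exact Finset.image_injective (Equiv.injective _) h

/-- For a laminar family, splitting every internal edge into two disjoint edges is enough to
have exactly two children. -/
theorem IsTreeShape.of_split {A : Finset ℕ} {t : Finset (Finset ℕ)} (hne : A.Nonempty)
    (hsub : ∀ E ∈ t, E ⊆ A) (hcard : ∀ E ∈ t, 2 ≤ E.card) (hground : 2 ≤ A.card → A ∈ t)
    (hlam : ∀ E ∈ edges A t, ∀ F ∈ edges A t, E ⊆ F ∨ F ⊆ E ∨ Disjoint E F)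
    (hsplit : ∀ E ∈ t, ∃ C₁ ∈ edges A t, ∃ C₂ ∈ edges A t, Disjoint C₁ C₂ ∧ C₁ ∪ C₂ = E) :
    IsTreeShape A t := by
  refine ⟨hne, hsub, hcard, hground, hlam, ?_⟩
  have hnon : ∀ E ∈ edges A t, E.Nonempty := by
    intro E hE
    rcases mem_edges.1 hE with h | ⟨a, -, rfl⟩
    · exact Finset.card_pos.1 (by have := hcard E h; omega)
    · exact Finset.singleton_nonempty a
  have key : ∀ C₁ ∈ edges A t, ∀ C₂ ∈ edges A t, Disjoint C₁ C₂ →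
      IsChild A t C₁ (C₁ ∪ C₂) := by
    intro C₁ h₁ C₂ h₂ hd
    obtain ⟨x, hx⟩ := hnon _ h₁
    obtain ⟨y, hy⟩ := hnon _ h₂
    rw [Finset.disjoint_left] at hd
    refine ⟨h₁, ⟨Finset.subset_union_left, fun h => ?_⟩, fun F hF h h' => ?_⟩
    · exact hd (h (Finset.mem_union_right _ hy)) hy
    · rcases hlam F hF C₂ h₂ with h3 | h3 | h3
      · exact hd hx (h3 (h.1 hx))
      · exact h'.2 (Finset.union_subset h.1 h3)
      · refine h.2 fun z hz => ?_
        rcases Finset.mem_union.1 (h'.1 hz) with h4 | h4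
        · exact h4
        · exact absurd h4 (Finset.disjoint_left.1 h3 hz)
  intro E hE
  obtain ⟨C₁, h₁, C₂, h₂, hd, rfl⟩ := hsplit E hE
  have k₁ := key C₁ h₁ C₂ h₂ hd
  have k₂ := key C₂ h₂ C₁ h₁ hd.symm
  rw [Finset.union_comm] at k₂
  refine ⟨C₁, C₂, k₁, k₂, ?_, hd, rfl, ?_⟩
  · rintro rfl
    exact (hnon _ h₁).ne_empty (disjoint_self.1 hd)
  · intro C hC
    have cmp : ∀ D, IsChild A t D (C₁ ∪ C₂) → C = D ∨ Disjoint C D := by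
      intro D hD
      rcases hlam C hC.1 D hD.1 with h | h | h
      · exact Or.inl (h.eq_or_ssubset.resolve_right fun h' => hC.2.2 D hD.1 h' hD.2.1)
      · exact Or.inl (h.eq_or_ssubset.resolve_right fun h' => hD.2.2 C hC.1 h' hC.2.1).symm
      · exact Or.inr h
    rcases cmp _ k₁ with h | h
    · exact Or.inl h
    rcases cmp _ k₂ with h' | h'
    · exact Or.inr h'
    obtain ⟨x, hx⟩ := hnon _ hC.1
    rcases Finset.mem_union.1 (hC.2.1.1 hx) with h3 | h3
    · exact absurd h3 (Finset.disjoint_left.1 h hx)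
    · exact absurd h3 (Finset.disjoint_left.1 h' hx)

theorem parentEdge_eq {t : Finset (Finset ℕ)} {E M : Finset ℕ} (hM : M ∈ t) (hEM : E ⊂ M)
    (hmin : ∀ F ∈ t, E ⊂ F → M ⊆ F) : parentEdge t E = M := by
  ext x
  simp only [parentEdge, Finset.mem_filter, Finset.mem_sup, id]
  exact ⟨fun h => h.2 M hM hEM, fun h => ⟨⟨M, hM, h⟩, fun F hF hEF => hmin F hF hEF h⟩⟩

namespace IsTreeShape

variable {A : Finset ℕ} {t : Finset (Finset ℕ)}

theorem nested_of_mem (ht : IsTreeShape A t) {E F : Finset ℕ} (hE : E ∈ edges A t)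
    (hF : F ∈ edges A t) {x : ℕ} (hxE : x ∈ E) (hxF : x ∈ F) : E ⊆ F ∨ F ⊆ E := by
  rcases ht.nested_or_disjoint E hE F hF with h | h | h
  · exact Or.inl h
  · exact Or.inr h
  · exact absurd hxF (Finset.disjoint_left.1 h hxE)

theorem parentEdge_spec (ht : IsTreeShape A t) {E F : Finset ℕ} (hE : E.Nonempty)
    (hF : F ∈ t) (hEF : E ⊂ F) :
    parentEdge t E ∈ t ∧ E ⊂ parentEdge t E ∧ ∀ G ∈ t, E ⊂ G → parentEdge t E ⊆ G := by
  obtain ⟨M, hM, hmin⟩ := Finset.exists_min_image (t.filter fun G => E ⊂ G) Finset.card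
    ⟨F, Finset.mem_filter.2 ⟨hF, hEF⟩⟩
  rw [Finset.mem_filter] at hM
  have hle : ∀ G ∈ t, E ⊂ G → M ⊆ G := by
    intro G hG hEG
    obtain ⟨x, hx⟩ := hE
    rcases ht.nested_of_mem (mem_edges.2 (Or.inl hM.1)) (mem_edges.2 (Or.inl hG))
      (hM.2.1 hx) (hEG.1 hx) with h | h
    · exact h
    · exact (Finset.eq_of_subset_of_card_le h (hmin G (Finset.mem_filter.2 ⟨hG, hEG⟩))).ge
  rw [parentEdge_eq hM.1 hM.2 hle]
  exact ⟨hM.1, hM.2, hle⟩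

theorem singleton_ssubset (ht : IsTreeShape A t) {E : Finset ℕ} (hE : E ∈ t) {a : ℕ}
    (ha : a ∈ E) : {a} ⊂ E := by
  refine ⟨Finset.singleton_subset_iff.2 ha, fun h => ?_⟩
  have := Finset.card_le_card h
  have := ht.two_le_card E hE
  simp at *
  omega

theorem leafParent_spec (ht : IsTreeShape A t) (hA : 2 ≤ A.card) {a : ℕ} (ha : a ∈ A) :
    parentEdge t {a} ∈ t ∧ a ∈ parentEdge t {a} ∧
      ∀ F ∈ t, a ∈ F → parentEdge t {a} ⊆ F := by
  have hAt := ht.ground_mem hA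
  obtain ⟨h1, h2, h3⟩ := ht.parentEdge_spec (Finset.singleton_nonempty a) hAt
    (ht.singleton_ssubset hAt ha)
  exact ⟨h1, Finset.singleton_subset_iff.1 h2.1,
    fun F hF haF => h3 F hF (ht.singleton_ssubset hF haF)⟩

theorem sibling_mem_edges (ht : IsTreeShape A t) (hA : 2 ≤ A.card) {i : ℕ} (hi : i ∈ A) :
    (parentEdge t {i}).erase i ∈ edges A t := by
  obtain ⟨hP, hiP, hmin⟩ := ht.leafParent_spec hA hi
  have key : ∀ C₁ C₂, IsChild A t C₁ (parentEdge t {i}) → C₂ ∈ edges A t →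
      Disjoint C₁ C₂ → C₁ ∪ C₂ = parentEdge t {i} → i ∈ C₁ →
      (parentEdge t {i}).erase i ∈ edges A t := by
    intro C₁ C₂ h₁ h₂ hd hu hiC
    rcases mem_edges.1 h₁.1 with h | ⟨a, -, rfl⟩
    · exact absurd (hmin C₁ h hiC) h₁.2.1.2
    · obtain rfl := Finset.mem_singleton.1 hiC
      rw [Finset.disjoint_singleton_left] at hd
      have : (parentEdge t {i}).erase i = C₂ := by
        rw [← hu, Finset.singleton_union, Finset.erase_insert hd]
      rwa [this]
  obtain ⟨C₁, C₂, h₁, h₂, -, hd, hu, -⟩ := ht.binary _ hP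
  rcases Finset.mem_union.1 (hu ▸ hiP : i ∈ C₁ ∪ C₂) with h | h
  · exact key C₁ C₂ h₁ h₂.1 hd hu h
  · exact key C₂ C₁ h₂ h₁.1 hd.symm (by rw [Finset.union_comm, hu]) h

/-- A leaf edge `{a}` whose parent is also the parent of `{i}` is the sibling of `{i}`. -/
theorem card_leafParent_eq_two (ht : IsTreeShape A t) (hA : 2 ≤ A.card) {i a : ℕ} (hi : i ∈ A)
    (ha : a ∈ A) (hai : a ≠ i) (h : parentEdge t {a} = parentEdge t {i}) :
    (parentEdge t {i}).card = 2 := by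
  obtain ⟨hP, hiP, -⟩ := ht.leafParent_spec hA hi
  obtain ⟨-, haP, hmin⟩ := ht.leafParent_spec hA ha
  rw [h] at haP hmin
  rcases mem_edges.1 (ht.sibling_mem_edges hA hi) with hS | ⟨b, -, hb⟩
  · exact absurd (hmin _ hS (Finset.mem_erase.2 ⟨hai, haP⟩) hiP) (Finset.notMem_erase _ _)
  · have := Finset.card_erase_add_one hiP
    rw [← hb] at this
    simpa using this.symm

theorem relabel_mem_edges (ht : IsTreeShape A t) {i j : ℕ} (hA : 2 ≤ A.card)
    (hi : i ∈ A) (hj : j ∈ A) {C : Finset ℕ} (hC : C ∈ edges A t) (hCi : C ≠ {i}) :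
    relabel i j C ∈
      edges (A.erase j) ((t.erase (parentEdge t {i})).image (relabel i j)) := by
  have key : ∀ D ∈ edges A t, D ≠ {i} → D ≠ parentEdge t {i} → relabel i j D ∈
      edges (A.erase j) ((t.erase (parentEdge t {i})).image (relabel i j)) := by
    intro D hD hDi hDP
    rw [mem_edges]
    rcases mem_edges.1 hD with h | ⟨a, ha, rfl⟩
    · exact Or.inl (Finset.mem_image_of_mem _ (Finset.mem_erase.2 ⟨hDP, h⟩))
    · have hai : a ≠ i := fun h => hDi (by rw [h])
      refine Or.inr ⟨Equiv.swap i j a, ?_, ?_⟩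
      · rw [← relabel_ground hi hj]
        exact swap_mem_relabel ha hai
      · rw [relabel_eq_image, Finset.erase_eq_of_notMem (by simpa using hai.symm),
          Finset.image_singleton]
  by_cases hCP : C = parentEdge t {i}
  · rw [hCP, ← relabel_erase]
    refine key _ (ht.sibling_mem_edges hA hi) (fun h => ?_) (fun h => ?_)
    · have : i ∈ (parentEdge t {i}).erase i := by rw [h]; exact Finset.mem_singleton_self i
      exact Finset.notMem_erase _ _ this
    · have := (ht.leafParent_spec hA hi).2.1
      rw [← h] at this
      exact Finset.notMem_erase _ _ this
  · exact key C hC hCi hCP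

theorem isTreeShape_relabel (ht : IsTreeShape A t) (hA : 2 ≤ A.card) {i j : ℕ} (hi : i ∈ A)
    (hj : j ∈ A) :
    IsTreeShape (A.erase j) ((t.erase (parentEdge t {i})).image (relabel i j)) := by
  obtain ⟨hP, hiP, hmin⟩ := ht.leafParent_spec hA hi
  have hedge : ∀ E' ∈ edges (A.erase j) ((t.erase (parentEdge t {i})).image (relabel i j)),
      ∃ E ∈ edges A t, relabel i j E = E' := by
    intro E' hE'
    rcases mem_edges.1 hE' with h | ⟨b, hb, rfl⟩
    · obtain ⟨E, hE, rfl⟩ := Finset.mem_image.1 h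
      exact ⟨E, mem_edges.2 (Or.inl (Finset.mem_of_mem_erase hE)), rfl⟩
    · rw [← relabel_ground hi hj, relabel_eq_image, Finset.mem_image] at hb
      obtain ⟨a, ha, rfl⟩ := hb
      rw [Finset.mem_erase] at ha
      refine ⟨{a}, mem_edges.2 (Or.inr ⟨a, ha.2, rfl⟩), ?_⟩
      rw [relabel_eq_image, Finset.erase_eq_of_notMem (by simpa using ha.1.symm),
        Finset.image_singleton]
  apply IsTreeShape.of_split
  · rw [← Finset.card_pos, Finset.card_erase_of_mem hj]
    omega
  · intro E' hE'
    obtain ⟨E, hE, rfl⟩ := Finset.mem_image.1 hE'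
    rw [← relabel_ground hi hj]
    exact relabel_mono (ht.subset_ground E (Finset.mem_of_mem_erase hE))
  · intro E' hE'
    obtain ⟨E, hE, rfl⟩ := Finset.mem_image.1 hE'
    rw [Finset.mem_erase] at hE
    rw [card_relabel]
    by_cases hiE : i ∈ E
    · have h1 := Finset.card_lt_card ((hmin E hE.2 hiE).ssubset_of_ne hE.1.symm)
      have h2 := ht.two_le_card _ hP
      rw [Finset.card_erase_of_mem hiE]
      omega
    · rw [Finset.erase_eq_of_notMem hiE]
      exact ht.two_le_card E hE.2
  · intro hA'
    have h := ht.relabel_mem_edges hA hi hj (mem_edges.2 (Or.inl (ht.ground_mem hA)))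
      (fun h => by rw [h] at hA; simp at hA)
    rw [relabel_ground hi hj] at h
    rcases mem_edges.1 h with h | ⟨a, -, h⟩
    · exact h
    · rw [← h] at hA'
      simp at hA'
  · intro E' hE' F' hF'
    obtain ⟨E, hE, rfl⟩ := hedge E' hE'
    obtain ⟨F, hF, rfl⟩ := hedge F' hF'
    rcases ht.nested_or_disjoint E hE F hF with h | h | h
    · exact Or.inl (relabel_mono h)
    · exact Or.inr (Or.inl (relabel_mono h))
    · refine Or.inr (Or.inr (Finset.disjoint_left.2 fun x hx hx' => ?_))
      exact Finset.disjoint_left.1 h (mem_relabel.1 hx).2 (mem_relabel.1 hx').2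
  · intro E' hE'
    obtain ⟨E, hE, rfl⟩ := Finset.mem_image.1 hE'
    rw [Finset.mem_erase] at hE
    obtain ⟨C₁, C₂, h₁, h₂, -, hd, hu, -⟩ := ht.binary E hE.2
    have hne : ∀ C, IsChild A t C E → C ≠ {i} := by
      rintro C hC rfl
      refine hC.2.2 _ (mem_edges.2 (Or.inl hP)) (ht.singleton_ssubset hP hiP) ?_
      exact (hmin E hE.2 (Finset.singleton_subset_iff.1 hC.2.1.1)).ssubset_of_ne hE.1.symm
    refine ⟨_, ht.relabel_mem_edges hA hi hj h₁.1 (hne _ h₁), _,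
      ht.relabel_mem_edges hA hi hj h₂.1 (hne _ h₂), Finset.disjoint_left.2 fun x hx hx' => ?_, ?_⟩
    · exact Finset.disjoint_left.1 hd (mem_relabel.1 hx).2 (mem_relabel.1 hx').2
    · ext x
      rw [← hu, Finset.mem_union, mem_relabel, mem_relabel, mem_relabel, Finset.mem_union]
      tauto

theorem relabel_injOn (ht : IsTreeShape A t) (hA : 2 ≤ A.card) {i j : ℕ} (hi : i ∈ A)
    {E F : Finset ℕ} (hE : E ∈ t.erase (parentEdge t {i})) (hF : F ∈ t.erase (parentEdge t {i}))
    (h : relabel i j E = relabel i j F) : E = F := by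
  obtain ⟨hP, hiP, hmin⟩ := ht.leafParent_spec hA hi
  have h' := erase_eq_of_relabel_eq h
  have key : ∀ E ∈ t.erase (parentEdge t {i}), ∀ F ∈ t, E.erase i = F.erase i →
      i ∈ E → i ∈ F := by
    intro E hE F hF hEF hiE
    by_contra hiF
    rw [Finset.mem_erase] at hE
    rw [Finset.erase_eq_of_notMem hiF] at hEF
    have hPE := hmin E hE.2 hiE
    obtain ⟨x, hxP, hxi⟩ := Finset.exists_mem_ne (ht.two_le_card _ hP) i
    have hxF : x ∈ F := hEF ▸ Finset.mem_erase.2 ⟨hxi, hPE hxP⟩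
    rcases ht.nested_of_mem (mem_edges.2 (Or.inl hP)) (mem_edges.2 (Or.inl hF)) hxP hxF
      with h3 | h3
    · exact hiF (h3 hiP)
    · refine hE.1 (Finset.Subset.antisymm ?_ hPE)
      rw [← Finset.insert_erase hiE, hEF]
      exact Finset.insert_subset hiP h3
  have hiff : i ∈ E ↔ i ∈ F :=
    ⟨key E hE F (Finset.mem_of_mem_erase hF) h', key F hF E (Finset.mem_of_mem_erase hE) h'.symm⟩
  by_cases hiE : i ∈ E
  · rw [← Finset.insert_erase hiE, h', Finset.insert_erase (hiff.1 hiE)]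
  · rwa [Finset.erase_eq_of_notMem hiE, Finset.erase_eq_of_notMem (mt hiff.2 hiE)] at h'

theorem Jmap_mem (ht : IsTreeShape A t) (hA : 2 ≤ A.card) {i : ℕ} (hi : i ∈ A) :
    Jmap A t i ∈ A := by
  obtain ⟨hP, hiP, -⟩ := ht.leafParent_spec hA hi
  have hmin : ∀ {E : Finset ℕ}, E.Nonempty → minLabel E ∈ E := fun {E} hE =>
    Finset.mem_coe.1 (Nat.sInf_mem (Finset.coe_nonempty.2 hE))
  have hmax : ∀ {a b : ℕ}, a ∈ A → b ∈ A → max a b ∈ A := by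
    intro a b ha hb
    rcases max_choice a b with h | h <;> rwa [h]
  have hsib : minLabel (parentEdge t {i} \ {i}) ∈ A := by
    obtain ⟨x, hxP, hxi⟩ := Finset.exists_mem_ne (ht.two_le_card _ hP) i
    have h := hmin (E := parentEdge t {i} \ {i}) ⟨x, by simp [hxP, hxi]⟩
    exact ht.subset_ground _ hP (Finset.mem_sdiff.1 h).1
  unfold Jmap
  split_ifs with h
  · rw [max_eq_left (Nat.zero_le _)]
    exact hmax hi hsib
  · refine hmax hi (hmax hsib ?_)
    obtain ⟨h1, h2, -⟩ := ht.parentEdge_spec ⟨i, hiP⟩ (ht.ground_mem hA)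
      ((ht.subset_ground _ hP).ssubset_of_ne h)
    have h3 := hmin (Finset.sdiff_nonempty.2 h2.2)
    exact ht.subset_ground _ h1 (Finset.mem_sdiff.1 h3).1

end IsTreeShape

theorem swapReduce_top_swap (T : ATree) {i j a : ℕ} (hai : a ≠ i) :
    (swapReduce i j T).top (Equiv.swap i j a) = T.top a := by
  simp only [swapReduce, Equiv.swap_apply_def]
  split_ifs <;> simp_all

theorem swapReduce_part_relabel {A : Finset ℕ} {T : ATree} (ht : IsTreeShape A T.shape)
    (hA : 2 ≤ A.card) {i j : ℕ} (hi : i ∈ A) {E : Finset ℕ}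
    (hE : E ∈ T.shape.erase (parentEdge T.shape {i})) :
    (swapReduce i j T).part (relabel i j E) = T.part E := by
  have h : ∃ F ∈ T.shape.erase (parentEdge T.shape {i}), relabel i j F = relabel i j E :=
    ⟨E, hE, rfl⟩
  simp only [swapReduce, dif_pos h]
  rw [ht.relabel_injOn hA hi h.choose_spec.1 hE h.choose_spec.2]

/-- **The swap-and-reduce map sends degenerate trees to nondegenerate trees:** if
`T ∈ 𝕋̃_A ∖ 𝕋_A` has its unique degenerate label `i = I(T)` and `j = J(T) = J(𝐭,i)`,
then `ϱ(T) ∈ 𝕋_{A∖{j}}`: it is an `(A∖{j})`-tree with no degenerate label whose type-2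
edges `{u,v}` all satisfy `x'_u + x'_v > 0`. -/
theorem swapReduce_mem (A : Finset ℕ) (hA : 2 ≤ A.card) (T : ATree)
    (hT : MemTtilde A T) (i : ℕ) (hi : i ∈ A) (hdeg : Degenerate T i)
    (j : ℕ) (hj : j = Jmap A T.shape i) :
    MemT (A.erase j) (swapReduce i j T) := by
  obtain ⟨⟨ht, hnn, hoff, hpart, hzero, htwo⟩, huniq⟩ := hT
  have hjA : j ∈ A := hj ▸ ht.Jmap_mem hA hi
  obtain ⟨hP, hiP, hmin⟩ := ht.leafParent_spec hA hi
  have hshape : (swapReduce i j T).shape =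
      (T.shape.erase (parentEdge T.shape {i})).image (relabel i j) := rfl
  have htopi : T.top i = 0 := by
    have h1 := hnn i hi
    have h2 := (hpart _ hP).1.1
    unfold Degenerate at hdeg
    linarith
  have hlabel : ∀ b ∈ A.erase j, ∃ a ∈ A, a ≠ i ∧ Equiv.swap i j a = b := by
    intro b hb
    rw [← relabel_ground hi hjA, relabel_eq_image, Finset.mem_image] at hb
    obtain ⟨a, ha, hab⟩ := hb
    exact ⟨a, (Finset.mem_erase.1 ha).2, (Finset.mem_erase.1 ha).1, hab⟩
  have hnn' : ∀ b ∈ A.erase j, 0 ≤ (swapReduce i j T).top b := by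
    intro b hb
    obtain ⟨a, ha, hai, rfl⟩ := hlabel b hb
    rw [swapReduce_top_swap T hai]
    exact hnn a ha
  have hpart' : ∀ E ∈ (swapReduce i j T).shape, MemIcal ((swapReduce i j T).part E) := by
    intro E' hE'
    obtain ⟨E, hE, rfl⟩ := Finset.mem_image.1 hE'
    rw [swapReduce_part_relabel ht hA hi hE]
    exact hpart E (Finset.mem_of_mem_erase hE)
  have hzero' : ∀ E, E ∉ (swapReduce i j T).shape → (swapReduce i j T).part E = IP.zero := by
    intro E hE
    refine dif_neg fun h => hE ?_
    exact Finset.mem_image.2 h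
  have hpos : ∀ E ∈ T.shape, E.card = 2 → ∃ a ∈ E, a ≠ i ∧ 0 < T.top a := by
    intro E hE hcard
    by_contra! hcon
    refine (htwo E hE hcard).not_ge (Finset.sum_nonpos fun a ha => ?_)
    by_cases hai : a = i
    · rw [hai, htopi]
    · exact hcon a ha hai
  have ht' := ht.isTreeShape_relabel hA hi hjA
  refine ⟨⟨ht', hnn', ?_, hpart', hzero', ?_⟩, ?_⟩
  · intro b hb
    rw [Finset.mem_erase, not_and] at hb
    simp only [swapReduce]
    split_ifs with h1 h2
    · rfl
    · exact absurd (h2 ▸ hi) (hb h1)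
    · exact hoff b (hb h1)
  · intro E' hE' hcard
    have hsub := ht'.subset_ground E' hE'
    obtain ⟨E, hE, rfl⟩ := Finset.mem_image.1 hE'
    rw [Finset.mem_erase] at hE
    rw [card_relabel] at hcard
    have hex : ∃ a ∈ E, a ≠ i ∧ 0 < T.top a := by
      by_cases hiE : i ∈ E
      · have hPE := hmin E hE.2 hiE
        have h1 := Finset.card_lt_card (hPE.ssubset_of_ne hE.1.symm)
        have h2 := ht.two_le_card _ hP
        rw [Finset.card_erase_of_mem hiE] at hcard
        obtain ⟨a, ha, h⟩ := hpos _ hP (by omega)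
        exact ⟨a, hPE ha, h⟩
      · rw [Finset.erase_eq_of_notMem hiE] at hcard
        exact hpos E hE.2 hcard
    obtain ⟨a, ha, hai, hlt⟩ := hex
    refine Finset.sum_pos' (fun b hb => hnn' b (hsub hb)) ⟨_, swap_mem_relabel ha hai, ?_⟩
    rwa [swapReduce_top_swap T hai]
  · intro b hb hd
    obtain ⟨a, ha, hai, rfl⟩ := hlabel b hb
    unfold Degenerate at hd
    rw [swapReduce_top_swap T hai] at hd
    obtain ⟨hQ, haQ, hQmin⟩ := ht.leafParent_spec hA ha
    by_cases hQP : parentEdge T.shape {a} = parentEdge T.shape {i}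
    · have hcard := ht.card_leafParent_eq_two hA hi ha hai hQP
      obtain ⟨c, hc, hci, hlt⟩ := hpos _ hP hcard
      have hca : c = a := by
        have h1 := Finset.card_erase_of_mem hiP
        rw [hcard] at h1
        exact Finset.card_le_one.1 h1.le c (Finset.mem_erase.2 ⟨hci, hc⟩) a
          (Finset.mem_erase.2 ⟨hai, hQP ▸ haQ⟩)
      rw [hca] at hlt
      have hmass : ∀ E, 0 ≤ ((swapReduce i j T).part E).1 := by
        intro E
        by_cases hE : E ∈ (swapReduce i j T).shape
        · exact (hpart' E hE).1.1
        · rw [hzero' E hE]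
          exact le_rfl
      have := hmass (parentEdge (swapReduce i j T).shape {Equiv.swap i j a})
      linarith
    · have hQ' := Finset.mem_erase.2 ⟨hQP, hQ⟩
      have hQt := Finset.mem_image_of_mem (relabel i j) hQ'
      have hpar : parentEdge (swapReduce i j T).shape {Equiv.swap i j a} =
          relabel i j (parentEdge T.shape {a}) := by
        refine parentEdge_eq hQt
          (ht'.singleton_ssubset hQt (swap_mem_relabel haQ hai)) fun F' hF' hsub => ?_
        obtain ⟨F, hF, rfl⟩ := Finset.mem_image.1 hF'
        have h := (mem_relabel.1 (Finset.singleton_subset_iff.1 hsub.1)).2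
        rw [Equiv.swap_apply_self] at h
        exact relabel_mono (hQmin F (Finset.mem_of_mem_erase hF) h)
      rw [hpar, swapReduce_part_relabel ht hA hi hQ'] at hd
      exact hai (huniq a ha i hi hd hdeg)

end

end AldousTrees
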